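/- Let a < b be reals and 0 < d < b - a. Let W, Z : ℝ → ℝ be differentiable at d and at b-a, with W(d) ≠ 0 and W(b-a) ≠ 0, and assume κ := -Z'(b-a) + (Z(b-a) - 1)·W'(b-a)/W(b-a) ≠ 0. Set h(d) = 1 - Z(b-a-d) + (Z(b-a) - 1)·W(b-a-d)/W(b-a). Then the limit as x → b from the left of h(d)·[Z(x-b+d) - Z(d)·W(x-b+d)/W(d)] / [1 - Z(x-a) + Z(b-a)·W(x-a)/W(b-a) - W(x-a)/W(b-a)] exists and equals [1 - Z(b-a-d) + (Z(b-a) - 1)·W(b-a-d)/W(b-a)] · [Z'(d) - Z(d)·W'(d)/W(d)] / [-Z'(b-a) + (Z(b-a) - 1)·W'(b-a)/W(b-a)]. -/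

import Mathlib

open Filter Set

/-- The quotient of two functions vanishing at a point tends to the quotient of their derivatives. -/
theorem HasDerivAt.tendsto_div_of_eq_zero {f g : ℝ → ℝ} {f' g' x₀ : ℝ}
    (hf : HasDerivAt f f' x₀) (hg : HasDerivAt g g' x₀)
    (hf₀ : f x₀ = 0) (hg₀ : g x₀ = 0) (hg' : g' ≠ 0) :
    Tendsto (fun x => f x / g x) (nhdsWithin x₀ {x₀}ᶜ) (nhds (f' / g')) := by
  refine ((hf.tendsto_slope.div hg.tendsto_slope hg')).congr' ?_
  filter_upwards [self_mem_nhdsWithin] with x hx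
  have hx' : x - x₀ ≠ 0 := sub_ne_zero.mpr hx
  simp only [Pi.div_apply, slope_def_field, hf₀, hg₀, sub_zero]
  exact div_div_div_cancel_right₀ hx' _ _

/-- The full analytic content of Corollary 2: with
`h(d) = 1 - Z(b-a-d) + (Z(b-a)-1)·W(b-a-d)/W(b-a)`, the limit as `x → b⁻` of
`h(d)·[Z(x-b+d) - Z(d)W(x-b+d)/W(d)] / [1 - Z(x-a) + Z(b-a)W(x-a)/W(b-a) - W(x-a)/W(b-a)]`
equals `h(d)·[Z'(d) - Z(d)W'(d)/W(d)] / [-Z'(b-a) + (Z(b-a)-1)W'(b-a)/W(b-a)]`. -/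
theorem maxLoss_postSupremum_limit
    (a b d : ℝ) (hab : a < b) (hd : 0 < d) (hdba : d < b - a)
    (W Z : ℝ → ℝ)
    (hWd : DifferentiableAt ℝ W d) (hWba : DifferentiableAt ℝ W (b - a))
    (hZd : DifferentiableAt ℝ Z d) (hZba : DifferentiableAt ℝ Z (b - a))
    (hWdne : W d ≠ 0) (hWbane : W (b - a) ≠ 0)
    (hκ : -deriv Z (b - a) + (Z (b - a) - 1) * deriv W (b - a) / W (b - a) ≠ 0) :
    Tendsto (fun x : ℝ =>
        (1 - Z (b - a - d) + (Z (b - a) - 1) * W (b - a - d) / W (b - a)) *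
          (Z (x - b + d) - Z d * W (x - b + d) / W d) /
        (1 - Z (x - a) + Z (b - a) * W (x - a) / W (b - a) - W (x - a) / W (b - a)))
      (nhdsWithin b (Iio b))
      (nhds ((1 - Z (b - a - d) + (Z (b - a) - 1) * W (b - a - d) / W (b - a)) *
        (deriv Z d - Z d * deriv W d / W d) /
        (-deriv Z (b - a) + (Z (b - a) - 1) * deriv W (b - a) / W (b - a)))) := by
  have hshift (f : ℝ → ℝ) (hf : DifferentiableAt ℝ f d) :
      HasDerivAt (fun x => f (x - b + d)) (deriv f d) b := by
    have h : HasDerivAt f (deriv f d) (b - b + d) := by simpa using hf.hasDerivAt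
    exact (h.comp b (((hasDerivAt_id b).sub_const b).add_const d)).congr_deriv (mul_one _)
  have hsub (f : ℝ → ℝ) (hf : DifferentiableAt ℝ f (b - a)) :
      HasDerivAt (fun x => f (x - a)) (deriv f (b - a)) b :=
    hf.hasDerivAt.comp_sub_const b a
  have hnum := ((hshift Z hZd).sub (((hshift W hWd).const_mul (Z d)).div_const (W d))).const_mul
    (1 - Z (b - a - d) + (Z (b - a) - 1) * W (b - a - d) / W (b - a))
  have hden : HasDerivAt
      (fun x => 1 - Z (x - a) + Z (b - a) * W (x - a) / W (b - a) - W (x - a) / W (b - a))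
      (-deriv Z (b - a) + (Z (b - a) - 1) * deriv W (b - a) / W (b - a)) b := by
    refine ((((hsub Z hZba).const_sub 1).add
      (((hsub W hWba).const_mul (Z (b - a))).div_const (W (b - a)))).sub
      ((hsub W hWba).div_const (W (b - a)))).congr_deriv ?_
    ring
  refine (hnum.tendsto_div_of_eq_zero hden ?_ ?_ hκ).mono_left
    (nhdsWithin_mono b fun x hx => ne_of_lt hx)
  · simp [hWdne]
  · field_simp
    ring
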